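/- Let α ∈ (1/2, 1/√2), δ_α = 1/4 − α/(2√2), ε_α = 1/(4α) − 1/(2√2), R₀ = [−2,2]×[−√2,√2], and R_ε = [−2−ε_α, 2+ε_α]×[−√2−ε_α, √2+ε_α]. Then for every s ∈ [0, δ_α]: F₁^s(R₀) ⊆ F₁^s(R_ε) ⊆ interior(R₀ ∩ {x ∈ ℝ² : x₁ ≥ δ_α}) and F₂^s(R₀) ⊆ F₂^s(R_ε) ⊆ interior(R₀ ∩ {x ∈ ℝ² : x₁ ≤ −δ_α}). -/

import Mathlib

open Set

noncomputable section

/-- Rotation by `π/2` about the origin. -/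
def Rot (x : ℝ × ℝ) : ℝ × ℝ := (-x.2, x.1)

/-- The time-dependent affine map `F₁ˢ x = (1 - s, 0) + α R x`. -/
def F1s (α s : ℝ) (x : ℝ × ℝ) : ℝ × ℝ := ((1 : ℝ) - s, 0) + α • Rot x

/-- The time-dependent affine map `F₂ˢ x = (-1 + s, 0) + α R x`. -/
def F2s (α s : ℝ) (x : ℝ × ℝ) : ℝ × ℝ := ((-1 : ℝ) + s, 0) + α • Rot x

/-- `F₁ˢ` or `F₂ˢ`, indexed by a letter of the alphabet `{1, 2}` (as a `Bool`,
`true ↦ F₁ˢ`, `false ↦ F₂ˢ`). -/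
def Fbs (α s : ℝ) (b : Bool) : ℝ × ℝ → ℝ × ℝ := if b then F1s α s else F2s α s

/-- For a finite word `w = (w₁, …, w_k)` (a `List Bool`), the composition
`F_wˢ = F_{w₁}ˢ ∘ … ∘ F_{w_k}ˢ`; the empty word gives the identity. -/
def Fws (α s : ℝ) (w : List Bool) : ℝ × ℝ → ℝ × ℝ :=
  w.foldr (fun b f => Fbs α s b ∘ f) id

/-- The rectangle `R₀ = [-2,2] × [-√2,√2]`. -/
def R0 : Set (ℝ × ℝ) := Icc (-2 : ℝ) 2 ×ˢ Icc (-(Real.sqrt 2)) (Real.sqrt 2)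

/-- The enlarged rectangle `R_ε = [-2-ε, 2+ε] × [-√2-ε, √2+ε]`. -/
def Re (ε : ℝ) : Set (ℝ × ℝ) :=
  Icc (-2 - ε) (2 + ε) ×ˢ Icc (-(Real.sqrt 2) - ε) (Real.sqrt 2 + ε)

/-- A set of points whose coordinates lie in open intervals is interior to any set containing the
open rectangle these intervals span. -/
lemma mem_interior_of_Ioo_prod_subset {a b c d : ℝ} {S : Set (ℝ × ℝ)}
    (h : Ioo a b ×ˢ Ioo c d ⊆ S) {x : ℝ × ℝ} (h₁ : x.1 ∈ Ioo a b) (h₂ : x.2 ∈ Ioo c d) :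
    x ∈ interior S :=
  interior_maximal h (isOpen_Ioo.prod isOpen_Ioo) ⟨h₁, h₂⟩

lemma R0_subset_Re {ε : ℝ} (hε : 0 ≤ ε) : R0 ⊆ Re ε :=
  prod_mono (Icc_subset_Icc (by linarith) (by linarith))
    (Icc_subset_Icc (by linarith) (by linarith))

/-- Coordinate bounds on `α x` for `x ∈ R_ε`. -/
lemma abs_mul_le_of_mem_Re {α ε : ℝ} (hα : 0 ≤ α) {x : ℝ × ℝ} (hx : x ∈ Re ε) :
    |α * x.1| ≤ α * (2 + ε) ∧ |α * x.2| ≤ α * (Real.sqrt 2 + ε) := by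
  obtain ⟨⟨h₁, h₂⟩, h₃, h₄⟩ := hx
  rw [abs_mul, abs_mul, abs_of_nonneg hα]
  exact ⟨mul_le_mul_of_nonneg_left (abs_le.2 ⟨by linarith, h₂⟩) hα,
    mul_le_mul_of_nonneg_left (abs_le.2 ⟨by linarith, h₄⟩) hα⟩

/-- For `α ∈ (1/2, 1/√2)`, `δ_α = 1/4 - α/(2√2)`,
`ε_α = 1/(4α) - 1/(2√2)` and every `s ∈ [0, δ_α]`:
`F₁ˢ(R₀) ⊆ F₁ˢ(R_ε) ⊆ int(R₀ ∩ {x₁ ≥ δ_α})` and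
`F₂ˢ(R₀) ⊆ F₂ˢ(R_ε) ⊆ int(R₀ ∩ {x₁ ≤ -δ_α})`. -/
theorem statement12 (α : ℝ) (hα : α ∈ Ioo (1/2 : ℝ) (Real.sqrt 2)⁻¹)
    (δ ε : ℝ) (hδ : δ = 1/4 - α / (2 * Real.sqrt 2))
    (hε : ε = 1 / (4 * α) - 1 / (2 * Real.sqrt 2)) :
    ∀ s ∈ Icc (0 : ℝ) δ,
      F1s α s '' R0 ⊆ F1s α s '' Re ε ∧
      F1s α s '' Re ε ⊆ interior (R0 ∩ {x : ℝ × ℝ | δ ≤ x.1}) ∧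
      F2s α s '' R0 ⊆ F2s α s '' Re ε ∧
      F2s α s '' Re ε ⊆ interior (R0 ∩ {x : ℝ × ℝ | x.1 ≤ -δ}) := by
  obtain ⟨hα₁, hα₂⟩ := hα
  have hα₀ : 0 < α := by linarith
  have hr : 0 < Real.sqrt 2 := by positivity
  have hr2 : Real.sqrt 2 * Real.sqrt 2 = 2 := Real.mul_self_sqrt (by norm_num)
  have hr1 : 1 < Real.sqrt 2 := by nlinarith
  have hαr : α * Real.sqrt 2 < 1 := by
    rwa [lt_inv_comm₀ hα₀ hr, ← one_div, lt_div_iff₀' hα₀] at hα₂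
  have hδr : α * Real.sqrt 2 = 1 - 4 * δ := by
    rw [hδ]; field_simp; linear_combination 2 * α * hr2
  have hαε : α * ε = δ := by
    rw [hδ, hε]; field_simp
  have hδ₀ : 0 < δ := by linarith
  have hε₀ : 0 < ε := pos_of_mul_pos_right (hαε ▸ hδ₀) hα₀.le
  have h2α : 2 * α = Real.sqrt 2 - 4 * (Real.sqrt 2 * δ) := by
    linear_combination Real.sqrt 2 * hδr - α * hr2
  have hrδ : δ < Real.sqrt 2 * δ := lt_mul_of_one_lt_left hδ₀ hr1
  rintro s ⟨hs₀, hs₁⟩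
  refine ⟨image_mono (R0_subset_Re hε₀.le), ?_, image_mono (R0_subset_Re hε₀.le), ?_⟩
  · rintro _ ⟨x, hx, rfl⟩
    obtain ⟨h₁, h₂⟩ := abs_mul_le_of_mem_Re hα₀.le hx
    rw [abs_le] at h₁ h₂
    refine mem_interior_of_Ioo_prod_subset
      (a := δ) (b := 2) (c := -Real.sqrt 2) (d := Real.sqrt 2) ?_ ?_ ?_
    · rintro y ⟨⟨h₃, h₄⟩, h₅⟩
      exact ⟨⟨⟨by linarith, h₄.le⟩, Ioo_subset_Icc_self h₅⟩, h₃.le⟩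
    all_goals
      simp only [F1s, Rot, Prod.fst_add, Prod.snd_add, Prod.smul_fst, Prod.smul_snd, smul_eq_mul]
      constructor <;> linarith
  · rintro _ ⟨x, hx, rfl⟩
    obtain ⟨h₁, h₂⟩ := abs_mul_le_of_mem_Re hα₀.le hx
    rw [abs_le] at h₁ h₂
    refine mem_interior_of_Ioo_prod_subset
      (a := -2) (b := -δ) (c := -Real.sqrt 2) (d := Real.sqrt 2) ?_ ?_ ?_
    · rintro y ⟨⟨h₃, h₄⟩, h₅⟩
      exact ⟨⟨⟨h₃.le, by linarith⟩, Ioo_subset_Icc_self h₅⟩, h₄.le⟩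
    all_goals
      simp only [F2s, Rot, Prod.fst_add, Prod.snd_add, Prod.smul_fst, Prod.smul_snd, smul_eq_mul]
      constructor <;> linarith

end
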